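/- arXiv:1401.5897 — 2 statements merged into one kernel-verified Lean document; each statement's English description precedes it below -/
import Mathlib

section
/- Equivalence of the stationary PDE and the Newton equation: with the change of variables y(x) = f(ũ(x)) where f' = e^C, C' = A/B, the function ũ satisfies ũ − φ₀(ψ₀(ũ)) = α²[A(ũ)(ũ')² + B(ũ)ũ''] if and only if y satisfies α² y'' = Ṽ'(y(x)), where Ṽ'(y) = (ũ − φ₀(ψ₀(ũ))) e^{C(ũ)}/B(ũ) with ũ = f⁻¹(y). -/
/-- Equivalence of the stationary PDE and the Newton equation under the
change of variables y = f(ũ), f' = e^C, C' = A/B. -/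
theorem stationary_pde_iff_newton
    (A B C f finv φ₀ ψ₀ : ℝ → ℝ) (α : ℝ) (hα : 0 < α)
    (hB : ∀ x, 0 < B x)
    (hC : ∀ x, HasDerivAt C (A x / B x) x)
    (hf : ∀ x, HasDerivAt f (Real.exp (C x)) x)
    (hinv : ∀ x, finv (f x) = x)
    (u du ddu : ℝ → ℝ)
    (hu : ∀ x, HasDerivAt u (du x) x)
    (hdu : ∀ x, HasDerivAt du (ddu x) x) :
    (∀ x ∈ Set.Icc (-1 : ℝ) 1,
      u x - φ₀ (ψ₀ (u x)) = α ^ 2 * (A (u x) * (du x) ^ 2 + B (u x) * ddu x)) ↔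
    (∀ x ∈ Set.Icc (-1 : ℝ) 1,
      α ^ 2 * deriv (deriv (f ∘ u)) x =
        (finv ((f ∘ u) x) - φ₀ (ψ₀ (finv ((f ∘ u) x)))) *
          Real.exp (C (finv ((f ∘ u) x))) / B (finv ((f ∘ u) x))) := by
  have h1 : deriv (f ∘ u) = fun x => Real.exp (C (u x)) * du x := by
    funext x
    exact ((hf (u x)).comp x (hu x)).deriv
  have h2 : ∀ x, deriv (deriv (f ∘ u)) x =
      Real.exp (C (u x)) * (A (u x) / B (u x) * du x) * du x + Real.exp (C (u x)) * ddu x := by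
    intro x
    rw [h1]
    have hc : HasDerivAt (fun x => C (u x)) (A (u x) / B (u x) * du x) x :=
      (hC (u x)).comp x (hu x)
    exact (hc.exp.mul (hdu x)).deriv
  refine forall₂_congr fun x _ => ?_
  rw [h2]
  simp only [Function.comp_apply, hinv]
  have hb := (hB (u x)).ne'
  have he := (Real.exp_pos (C (u x))).ne'
  rw [eq_div_iff hb]
  have key : α ^ 2 * (Real.exp (C (u x)) * (A (u x) / B (u x) * du x) * du x
      + Real.exp (C (u x)) * ddu x) * B (u x)
      = (α ^ 2 * (A (u x) * (du x) ^ 2 + B (u x) * ddu x)) * Real.exp (C (u x)) := by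
    field_simp
  rw [key, mul_left_inj' he]
  exact eq_comm
end

section
/- Second-order Taylor expansion of the averaged update: if v : ℝ → ℝ is C³ and φ : ℝ^d → ℝ is C², then (2α)^{-d} ∫_{[−α,α]^d} φ(v(x+ω₁),...,v(x+ω_d)) dω = φ₀(v(x)) + (α²/6)[Δφ(v(x))·(v'(x))² + φ₀'(v(x))·v''(x)] + o(α²) as α → 0⁺, where φ₀(t) = φ(t,...,t), φ₀'(t) = Σⱼ ∂ⱼφ(t,...,t), and Δφ(t) = Σⱼ ∂ⱼ²φ(t,...,t). -/
open MeasureTheory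

open Asymptotics Filter Topology in
lemma taylor_two_aux {E : Type*} [NormedAddCommGroup E] [NormedSpace ℝ E] (f : E → ℝ) (p : E)
    (hf : ContDiffAt ℝ 2 f p) :
    (fun h : E => f (p + h) - f p - fderiv ℝ f p h - 1 / 2 * fderiv ℝ (fderiv ℝ f) p h h)
      =o[𝓝 0] fun h => ‖h‖ ^ 2 := by
  have hsym : IsSymmSndFDerivAt ℝ f p := hf.isSymmSndFDerivAt (by simp)
  have hd : ∀ᶠ y in 𝓝 p, DifferentiableAt ℝ f y := by
    filter_upwards [hf.eventually (by simp)] with y hy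
    exact hy.differentiableAt (by simp)
  have hd2 : DifferentiableAt ℝ (fderiv ℝ f) p :=
    (hf.fderiv_right (m := 1) (by norm_num)).differentiableAt (by simp)
  have ht : Tendsto (fun h : E => p + h) (𝓝 0) (𝓝 p) := by
    have : Continuous (fun h : E => p + h) := by fun_prop
    simpa using this.tendsto 0
  obtain ⟨r, hr, hball⟩ := Metric.eventually_nhds_iff_ball.1 (ht.eventually hd)
  set B := fderiv ℝ (fderiv ℝ f) p with hB
  have key := (convex_ball (0 : E) r).isLittleO_pow_succ (x₀ := (0 : E)) (n := 1)
    (f := fun h : E => f (p + h) - f p - fderiv ℝ f p h - 1 / 2 * B h h)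
    (f' := fun h => fderiv ℝ f (p + h) - fderiv ℝ f p - B h) (Metric.mem_ball_self hr) ?_ ?_
  · rw [(Metric.isOpen_ball).nhdsWithin_eq (Metric.mem_ball_self hr)] at key
    simpa using key
  · intro h hh
    apply HasFDerivAt.hasFDerivWithinAt
    have h1 : HasFDerivAt (fun h : E => f (p + h)) (fderiv ℝ f (p + h)) h :=
      by
      have := (hball h hh).hasFDerivAt.comp h ((hasFDerivAt_id h).const_add p)
      simpa [Function.comp_def] using this
    have h2 : HasFDerivAt (fun h : E => B h h) (B h + B.flip h) h := by
      have := (B.hasFDerivAt (x := h)).clm_apply (hasFDerivAt_id h)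
      refine this.congr_fderiv ?_
      ext w; simp
    refine (((h1.sub_const (f p)).sub (fderiv ℝ f p).hasFDerivAt).sub
      (h2.const_mul (1/2))).congr_fderiv ?_
    ext w
    have := hsym h w
    simp only [_root_.sub_apply, _root_.smul_apply,
      _root_.add_apply, ContinuousLinearMap.flip_apply, smul_eq_mul]
    rw [← hB] at this
    rw [this]; ring
  · rw [(Metric.isOpen_ball).nhdsWithin_eq (Metric.mem_ball_self hr)]
    have := hasFDerivAt_iff_isLittleO_nhds_zero.1 hd2.hasFDerivAt
    simpa using this.norm_right

open Asymptotics Filter Topology in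
lemma expansion_aux {d : ℕ} (x : ℝ) (v : ℝ → ℝ) (φ : (Fin d → ℝ) → ℝ)
    (hv : ContDiffAt ℝ 3 v x) (hφ : ContDiff ℝ 2 φ) :
    (fun ω : Fin d → ℝ => φ (fun j => v (x + ω j)) -
      (φ (fun _ => v x) + deriv v x * fderiv ℝ φ (fun _ => v x) ω
        + 1 / 2 * deriv (deriv v) x * fderiv ℝ φ (fun _ => v x) (fun j => ω j ^ 2)
        + 1 / 2 * (deriv v x) ^ 2 * fderiv ℝ (fderiv ℝ φ) (fun _ => v x) ω ω))
      =o[𝓝 0] fun ω => ‖ω‖ ^ 2 := by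
  set p : Fin d → ℝ := fun _ => v x with hp
  set L := fderiv ℝ φ p
  set B := fderiv ℝ (fderiv ℝ φ) p
  set a := deriv v x with ha
  set b := deriv (deriv v) x with hb
  let k : (Fin d → ℝ) → (Fin d → ℝ) := fun ω j => v (x + ω j) - v x
  have hv1 := taylor_two_aux v x (hv.of_le (by norm_num))
  have hv2 : (fun h : ℝ => v (x + h) - v x - a * h - 1 / 2 * b * h ^ 2)
      =o[𝓝 0] fun h => ‖h‖ ^ 2 := by
    refine hv1.congr_left fun h => ?_
    have e1 : fderiv ℝ v x h = a * h := by
      rw [ha, ← toSpanSingleton_deriv]; simp [mul_comm]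
    have hd2 : DifferentiableAt ℝ (fderiv ℝ v) x :=
      (hv.fderiv_right (m := 1) (by norm_num)).differentiableAt (by simp)
    have e2 : fderiv ℝ (fderiv ℝ v) x h h = b * h ^ 2 := by
      have h3 : HasDerivAt (fun y => fderiv ℝ v y 1) (fderiv ℝ (fderiv ℝ v) x 1 1) x := by
        have := (hd2.hasFDerivAt.clm_apply (hasFDerivAt_const (1:ℝ) x)).hasDerivAt
        simpa using this
      have h4 : b = fderiv ℝ (fderiv ℝ v) x 1 1 := by
        rw [← h3.deriv]; simp [hb]
      have : h = h • (1:ℝ) := by simp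
      rw [h4, this, map_smul]; simp; ring
    rw [e1, e2]; ring
  have hproj : ∀ j : Fin d, Tendsto (fun ω : Fin d → ℝ => ω j) (𝓝 0) (𝓝 0) := fun j => by
    simpa using (continuous_apply j).tendsto (0 : Fin d → ℝ)
  have hcoord : ∀ j : Fin d, (fun ω : Fin d → ℝ => ω j) =O[𝓝 0] fun ω => ‖ω‖ := fun j =>
    IsBigO.of_bound 1 (Eventually.of_forall fun ω => by simpa using norm_le_pi_norm ω j)
  have hk : (fun ω => k ω - (a • ω + (1 / 2 * b) • fun j => ω j ^ 2)) =o[𝓝 0]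
      fun ω : Fin d → ℝ => ‖ω‖ ^ 2 := by
    rw [isLittleO_pi]
    intro j
    have h1 := (hv2.comp_tendsto (hproj j)).trans_isBigO
      (show _ =O[𝓝 0] fun ω : Fin d → ℝ => ‖ω‖ ^ 2 from ((hcoord j).norm_left.pow 2))
    refine h1.congr_left fun ω => ?_
    simp [k]; ring
  have hsq : (fun ω : Fin d → ℝ => fun j => ω j ^ 2) =O[𝓝 0] fun ω => ‖ω‖ ^ 2 := by
    rw [isBigO_pi]
    exact fun j => (hcoord j).pow 2
  have hk2 : (fun ω => k ω - a • ω) =O[𝓝 0] fun ω : Fin d → ℝ => ‖ω‖ ^ 2 := by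
    refine (hk.isBigO.add (hsq.const_smul_left (1 / 2 * b))).congr_left fun ω => ?_
    simp; abel
  have hto : (fun ω : Fin d → ℝ => ‖ω‖ ^ 2) =o[𝓝 0] fun ω => ‖ω‖ := by
    have := (isLittleO_pow_id (𝕜 := ℝ) (n := 2) (by norm_num)).comp_tendsto
      (k := fun ω : Fin d → ℝ => ‖ω‖) (by simpa using (continuous_norm (E := Fin d → ℝ)).tendsto 0)
    exact this
  have hω : (fun ω : Fin d → ℝ => a • ω) =O[𝓝 0] fun ω => ‖ω‖ :=
    ((isBigO_refl (fun ω : Fin d → ℝ => ω) (𝓝 0)).const_smul_left a).norm_right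
  have hk2' := hk2.trans_isLittleO hto
  have hk3 : k =O[𝓝 0] fun ω : Fin d → ℝ => ‖ω‖ := by
    refine (hk2'.isBigO.add hω).congr_left fun ω => ?_
    simp
  have hk0 : Tendsto k (𝓝 0) (𝓝 0) :=
    hk3.trans_tendsto (by simpa using (continuous_norm (E := Fin d → ℝ)).tendsto 0)
  have hT := ((taylor_two_aux φ p hφ.contDiffAt).comp_tendsto hk0).trans_isBigO
    (show _ =O[𝓝 0] fun ω : Fin d → ℝ => ‖ω‖ ^ 2 from (hk3.norm_left.pow 2))
  have hL := (L.isBigO_comp (fun ω => k ω - (a • ω + (1 / 2 * b) • fun j => ω j ^ 2))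
    (𝓝 0)).trans_isLittleO hk
  have hBb : ∀ u w : (Fin d → ℝ) → (Fin d → ℝ), (fun ω => B (u ω) (w ω)) =O[𝓝 0]
      fun ω => ‖u ω‖ * ‖w ω‖ := fun u w =>
    IsBigO.of_bound ‖B‖ (Eventually.of_forall fun ω => by
      simpa [mul_assoc] using B.le_opNorm₂ (u ω) (w ω))
  have hB1 := (hBb (fun ω => k ω - a • ω) k).trans_isLittleO
    (hk2'.norm_left.mul_isBigO hk3.norm_left)
  have hB2 := (hBb (fun ω => a • ω) (fun ω => k ω - a • ω)).trans_isLittleO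
    (hω.norm_left.mul_isLittleO hk2'.norm_left)
  have hB3 : (fun ω => 1 / 2 * (B (k ω - a • ω) (k ω) + B (a • ω) (k ω - a • ω)))
      =o[𝓝 0] fun ω : Fin d → ℝ => ‖ω‖ ^ 2 := by
    refine ((hB1.add hB2).const_mul_left (1/2)).congr_right fun ω => ?_
    ring
  refine ((hT.add hL).add hB3).congr_left fun ω => ?_
  have e : p + k ω = fun j => v (x + ω j) := by
    ext j; simp [p, k]
  simp only [Function.comp, e, map_sub, map_add, map_smul, _root_.sub_apply,
    _root_.smul_apply, smul_eq_mul]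
  ring

lemma clm_sum_aux {d : ℕ} {F : Type*} [NormedAddCommGroup F] [NormedSpace ℝ F]
    (L : (Fin d → ℝ) →L[ℝ] F) (ω : Fin d → ℝ) :
    L ω = ∑ j, ω j • L (Pi.single j (1 : ℝ)) := by
  conv_lhs => rw [pi_eq_sum_univ' ω]
  rw [map_sum]
  refine Finset.sum_congr rfl fun j _ => ?_
  rw [map_smul]

lemma integral_cube_prod_aux (d : ℕ) (α : ℝ) (f : Fin d → ℝ → ℝ) :
    ∫ ω in Set.Icc (fun _ : Fin d => -α) (fun _ => α), ∏ k, f k (ω k)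
      = ∏ k, ∫ t in Set.Icc (-α) α, f k t := by
  rw [← Set.pi_univ_Icc, volume_pi, Measure.restrict_pi_pi, integral_fintype_prod_eq_prod]

lemma integral_t_aux (α : ℝ) (h : 0 < α) : ∫ t in Set.Icc (-α) α, t = 0 := by
  rw [integral_Icc_eq_integral_Ioc, ← intervalIntegral.integral_of_le (by linarith)]
  simp

lemma integral_t2_aux (α : ℝ) (h : 0 < α) :
    ∫ t in Set.Icc (-α) α, t ^ 2 = 2 * α * (α ^ 2 / 3) := by
  rw [integral_Icc_eq_integral_Ioc, ← intervalIntegral.integral_of_le (by linarith)]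
  rw [integral_pow]; norm_num; ring

lemma integral_one_aux (α : ℝ) (h : 0 < α) : ∫ _t in Set.Icc (-α) α, (1 : ℝ) = 2 * α := by
  simp; rw [max_eq_left (by linarith)]; ring

lemma moment_one_aux (d : ℕ) (α : ℝ) (h : 0 < α) (i : Fin d) :
    ∫ ω in Set.Icc (fun _ : Fin d => -α) (fun _ => α), ω i = 0 := by
  have := integral_cube_prod_aux d α (fun k t => if k = i then t else 1)
  simp only [Finset.prod_ite_eq', Finset.mem_univ, if_true] at this
  rw [this]
  refine Finset.prod_eq_zero (Finset.mem_univ i) ?_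
  simpa using integral_t_aux α h

lemma moment_two_aux (d : ℕ) (α : ℝ) (h : 0 < α) (i j : Fin d) :
    ∫ ω in Set.Icc (fun _ : Fin d => -α) (fun _ => α), ω i * ω j
      = if i = j then (2 * α) ^ d * (α ^ 2 / 3) else 0 := by
  have := integral_cube_prod_aux d α
    (fun k t => (if k = i then t else 1) * (if k = j then t else 1))
  simp only [Finset.prod_mul_distrib, Finset.prod_ite_eq', Finset.mem_univ, if_true] at this
  rw [this]
  split_ifs with hij
  · subst hij
    have : ∀ k : Fin d, (∫ t in Set.Icc (-α) α, (if k = i then t else 1) * (if k = i then t else 1))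
        = 2 * α * (if k = i then α ^ 2 / 3 else 1) := by
      intro k
      by_cases hk : k = i
      · simp only [hk, if_true, ← pow_two, integral_t2_aux α h]
      · simp only [hk, if_false, mul_one, integral_one_aux α h]
    simp only [this, Finset.prod_mul_distrib, Finset.prod_ite_eq', Finset.mem_univ, if_true]
    rw [← Finset.prod_mul_distrib]
    simp
  · refine Finset.prod_eq_zero (Finset.mem_univ i) ?_
    simpa [hij] using integral_t_aux α h

lemma volume_cube_aux (d : ℕ) (α : ℝ) (h : 0 < α) :
    (volume : Measure (Fin d → ℝ)).real (Set.Icc (fun _ : Fin d => -α) (fun _ => α))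
      = (2 * α) ^ d := by
  rw [Measure.real, Real.volume_Icc_pi_toReal (fun _ => by simp; linarith)]
  simp; congr 1; ring

lemma integral_poly_aux (d : ℕ) (α : ℝ) (h : 0 < α) (c a b : ℝ) (L : (Fin d → ℝ) →L[ℝ] ℝ)
    (B : (Fin d → ℝ) →L[ℝ] (Fin d → ℝ) →L[ℝ] ℝ) :
    ∫ ω in Set.Icc (fun _ : Fin d => -α) (fun _ => α),
      (c + a * L ω + 1 / 2 * b * L (fun j => ω j ^ 2) + 1 / 2 * a ^ 2 * B ω ω)
    = (2 * α) ^ d * (c + α ^ 2 / 6 *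
        ((∑ j, B (Pi.single j 1) (Pi.single j 1)) * a ^ 2 + L (fun _ => 1) * b)) := by
  have hint : ∀ f : (Fin d → ℝ) → ℝ, Continuous f →
      IntegrableOn f (Set.Icc (fun _ : Fin d => -α) (fun _ => α)) := fun f hf =>
    hf.continuousOn.integrableOn_compact isCompact_Icc
  have i1 : ∫ ω in Set.Icc (fun _ : Fin d => -α) (fun _ => α), L ω = 0 := by
    rw [show (fun ω => L ω) = fun ω => ∑ j, ω j • L (Pi.single j (1 : ℝ)) from
      funext fun ω => clm_sum_aux L ω]
    rw [integral_finsetSum _ (fun i _ => hint _ (by fun_prop))]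
    simp only [smul_eq_mul, integral_mul_const, moment_one_aux d α h, zero_mul,
      Finset.sum_const_zero]
  have i2 : ∫ ω in Set.Icc (fun _ : Fin d => -α) (fun _ => α), L (fun j => ω j ^ 2)
      = (2 * α) ^ d * (α ^ 2 / 3) * L (fun _ => 1) := by
    rw [show (fun ω : Fin d → ℝ => L (fun j => ω j ^ 2))
        = fun ω => ∑ j, ω j * ω j * L (Pi.single j (1 : ℝ)) from
      funext fun ω => by rw [clm_sum_aux L]; simp only [smul_eq_mul, pow_two],
      clm_sum_aux L (fun _ => 1)]
    rw [integral_finsetSum _ (fun i _ => hint _ (by fun_prop))]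
    simp only [integral_mul_const, moment_two_aux d α h, if_true, Finset.mul_sum, one_smul]
  have i3 : ∫ ω in Set.Icc (fun _ : Fin d => -α) (fun _ => α), B ω ω
      = (2 * α) ^ d * (α ^ 2 / 3) * ∑ j, B (Pi.single j 1) (Pi.single j 1) := by
    have e : ∀ ω : Fin d → ℝ, B ω ω
        = ∑ i, ∑ j, ω i * ω j * B (Pi.single i 1) (Pi.single j 1) := by
      intro ω
      conv_lhs => rw [clm_sum_aux B ω, _root_.sum_apply]
      refine Finset.sum_congr rfl fun i _ => ?_
      rw [_root_.smul_apply, clm_sum_aux (B (Pi.single i 1)) ω, Finset.smul_sum]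
      refine Finset.sum_congr rfl fun j _ => ?_
      simp only [smul_eq_mul]; ring
    rw [show (fun ω => B ω ω) = _ from funext e]
    rw [integral_finsetSum _ (fun i _ => hint _ (by fun_prop)), Finset.mul_sum]
    refine Finset.sum_congr rfl fun i _ => ?_
    rw [integral_finsetSum _ (fun i _ => hint _ (by fun_prop))]
    simp only [integral_mul_const, moment_two_aux d α h]
    simp
  rw [integral_add (hint _ (by fun_prop)) (hint _ (by fun_prop)),
    integral_add (hint _ (by fun_prop)) (hint _ (by fun_prop)),
    integral_add (hint _ (by fun_prop)) (hint _ (by fun_prop)),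
    integral_const_mul, integral_const_mul, integral_const_mul, i1, i2, i3,
    setIntegral_const, volume_cube_aux d α h, smul_eq_mul]
  ring

/-- Second-order Taylor expansion of the cube-averaged update:
(2α)^{-d} ∫_{[−α,α]^d} φ(v(x+ω₁),...,v(x+ω_d)) dω
= φ₀(v(x)) + (α²/6)[Δφ(v(x)) (v'(x))² + φ₀'(v(x)) v''(x)] + o(α²) as α → 0⁺. -/
theorem cube_average_taylor
    (d : ℕ) (x : ℝ) (v : ℝ → ℝ) (φ : (Fin d → ℝ) → ℝ)
    (hv : ContDiffAt ℝ 3 v x) (hφ : ContDiff ℝ 2 φ) :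
    (fun α : ℝ =>
        (1 / (2 * α) ^ d) *
            (∫ ω in Set.Icc (fun _ : Fin d => -α) (fun _ => α), φ (fun j => v (x + ω j)))
          - (φ (fun _ => v x)
            + α ^ 2 / 6 *
              ((∑ j : Fin d,
                  iteratedFDeriv ℝ 2 φ (fun _ => v x) (fun _ => Pi.single j (1 : ℝ)))
                  * (deriv v x) ^ 2
                + deriv (fun t => φ (fun _ => t)) (v x) * deriv (deriv v) x)))
      =o[nhdsWithin 0 (Set.Ioi 0)] (fun α : ℝ => α ^ 2) := by
  have hdiag : deriv (fun t => φ (fun _ => t)) (v x) = fderiv ℝ φ (fun _ => v x) (fun _ => 1) := by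
    have h1 : HasDerivAt (fun t : ℝ => (fun _ : Fin d => t)) (fun _ => 1) (v x) :=
      hasDerivAt_pi.2 fun _ => hasDerivAt_id _
    have h2 : HasFDerivAt φ (fderiv ℝ φ (fun _ => v x)) (fun _ => v x) :=
      (hφ.differentiable (by simp) _).hasFDerivAt
    exact (h2.comp_hasDerivAt (v x) h1).deriv
  simp only [iteratedFDeriv_two_apply, hdiag]
  have hcv : ∀ᶠ y in nhds x, ContinuousAt v y := by
    filter_upwards [hv.eventually (by simp)] with y hy
    exact hy.continuousAt
  obtain ⟨r, hr, hball⟩ := Metric.eventually_nhds_iff_ball.1 hcv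
  have hexp := expansion_aux x v φ hv hφ
  rw [Asymptotics.isLittleO_iff] at hexp ⊢
  intro ε hε
  obtain ⟨δ, hδ, hR⟩ := Metric.eventually_nhds_iff_ball.1 (hexp hε)
  have hmem : Set.Ioo (0 : ℝ) (min r δ) ∈ nhdsWithin (0 : ℝ) (Set.Ioi 0) :=
    Ioo_mem_nhdsGT (lt_min hr hδ)
  filter_upwards [hmem] with α hα
  obtain ⟨h0, hα2⟩ := hα
  have hαr := hα2.trans_le (min_le_left _ _)
  have hαδ := hα2.trans_le (min_le_right _ _)
  have hnorm : ∀ ω ∈ Set.Icc (fun _ : Fin d => -α) (fun _ => α), ‖ω‖ ≤ α := by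
    intro ω hω
    rw [pi_norm_le_iff_of_nonneg h0.le]
    intro j
    rw [Real.norm_eq_abs, abs_le]
    exact ⟨hω.1 j, hω.2 j⟩
  have hF : IntegrableOn (fun ω : Fin d → ℝ => φ (fun j => v (x + ω j)))
      (Set.Icc (fun _ : Fin d => -α) (fun _ => α)) := by
    refine ContinuousOn.integrableOn_compact isCompact_Icc ?_
    refine hφ.continuous.comp_continuousOn ?_
    rw [continuousOn_pi]
    intro j ω hω
    have hy : x + ω j ∈ Metric.ball x r := by
      have := (norm_le_pi_norm ω j).trans (hnorm ω hω)
      simpa using this.trans_lt hαr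
    have : ContinuousAt (fun ω : Fin d → ℝ => v (x + ω j)) ω :=
      ContinuousAt.comp (f := fun ω : Fin d → ℝ => x + ω j) (hball _ hy)
        (Continuous.continuousAt (by fun_prop))
    exact this.continuousWithinAt
  set L := fderiv ℝ φ (fun _ => v x)
  set B := fderiv ℝ (fderiv ℝ φ) (fun _ => v x)
  set a := deriv v x
  set b := deriv (deriv v) x
  have hP : IntegrableOn (fun ω : Fin d → ℝ => φ (fun _ => v x) + a * L ω
      + 1 / 2 * b * L (fun j => ω j ^ 2) + 1 / 2 * a ^ 2 * B ω ω)
      (Set.Icc (fun _ : Fin d => -α) (fun _ => α)) :=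
    ContinuousOn.integrableOn_compact isCompact_Icc (Continuous.continuousOn (by fun_prop))
  have hbound := norm_setIntegral_le_of_norm_le_const (μ := volume) (C := ε * α ^ 2)
    (s := Set.Icc (fun _ : Fin d => -α) (fun _ => α))
    (f := fun ω => φ (fun j => v (x + ω j)) - (φ (fun _ => v x) + a * L ω
      + 1 / 2 * b * L (fun j => ω j ^ 2) + 1 / 2 * a ^ 2 * B ω ω))
    isCompact_Icc.measure_lt_top (by
      intro ω hω
      have hn := hnorm ω hω
      refine (hR ω (by simpa using hn.trans_lt hαδ)).trans ?_
      rw [norm_pow, norm_norm]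
      gcongr)
  rw [integral_sub hF hP, integral_poly_aux d α h0, volume_cube_aux d α h0] at hbound
  have hM : 0 < (2 * α) ^ d := by positivity
  rw [Real.norm_eq_abs (α ^ 2), abs_of_nonneg (sq_nonneg α)]
  refine le_of_mul_le_mul_right (le_trans (le_of_eq ?_) hbound) hM
  conv_lhs => rw [← Real.norm_of_nonneg hM.le, ← norm_mul]
  congr 1
  rw [Real.norm_of_nonneg hM.le]
  field_simp
end
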